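/- Fix q ∈ (0,1), β ∈ [0,∞), γ ∈ (0,∞), and ζ ∈ (0, (min{q,1−q})^{1/(β+1)}/γ]. Let F be the CDF of a (β,γ,ζ)-clustered probability distribution on [0,∞) with mean at most 1, and let â be the SAA decision based on n IID samples from F. Then for every number of samples n ≥ 1, the expected additive regret satisfies E[L(â)] − L(a*) ≤ (2/γ)·(1/(β+1) + 1/√e)·(1/(2√n))^{(β+2)/(β+1)} + (q+1)/(n·(γζ)^{β+1}). -/

import Mathlib

open MeasureTheory Set

noncomputable section

/-- The Newsvendor loss `ℓ(a,Z) = q·max{Z−a,0} + (1−q)·max{a−Z,0}` with critical quantile `q`. -/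
def nvLoss (q a z : ℝ) : ℝ := q * max (z - a) 0 + (1 - q) * max (a - z) 0

/-- The expected Newsvendor loss `L(a)` under the demand distribution `μ`. -/
def expLoss (q : ℝ) (μ : Measure ℝ) (a : ℝ) : ℝ := ∫ z, nvLoss q a z ∂μ

/-- The CDF of the demand distribution `μ`. -/
def cdf' (μ : Measure ℝ) (z : ℝ) : ℝ := (μ (Iic z)).toReal

/-- The optimal decision `a* = inf {a ≥ 0 : F(a) ≥ q}`. -/
def optDec (q : ℝ) (μ : Measure ℝ) : ℝ := sInf {a : ℝ | 0 ≤ a ∧ q ≤ cdf' μ a}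

/-- The empirical CDF of the samples `ω : Fin n → ℝ`. -/
def empCdf (n : ℕ) (ω : Fin n → ℝ) (z : ℝ) : ℝ :=
  (∑ i : Fin n, if ω i ≤ z then (1 : ℝ) else 0) / n

/-- The SAA (sample average approximation) decision `â = inf {a ≥ 0 : F̂(a) ≥ q}`. -/
def saa (q : ℝ) (n : ℕ) (ω : Fin n → ℝ) : ℝ := sInf {a : ℝ | 0 ≤ a ∧ q ≤ empCdf n ω a}

/-- The joint law of `n` iid samples from `μ`. -/
def iid (μ : Measure ℝ) (n : ℕ) : Measure (Fin n → ℝ) := Measure.pi fun _ => μ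

/-- A distribution `μ` is `(β,γ,ζ)`-clustered if
`|a − a*| ≤ (1/γ)·|F(a) − q|^{1/(β+1)}` for all `a ∈ [a*−ζ, a*+ζ]`. -/
def Clustered (q β γ ζ : ℝ) (μ : Measure ℝ) : Prop :=
  ∀ a ∈ Icc (optDec q μ - ζ) (optDec q μ + ζ),
    |a - optDec q μ| ≤ (1 / γ) * |cdf' μ a - q| ^ ((1 : ℝ) / (β + 1))


open Filter Topology ProbabilityTheory

section Calculus

theorem mul_exp_neg_sq_le (s : ℝ) :
    s * Real.exp (-(s ^ 2) / 2) ≤ Real.exp (-1 / 2) := by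
  have h1 : s ≤ Real.exp ((s ^ 2 - 1) / 2) := by
    have := Real.add_one_le_exp ((s ^ 2 - 1) / 2)
    nlinarith [sq_nonneg (s - 1)]
  calc s * Real.exp (-(s ^ 2) / 2)
      ≤ Real.exp ((s ^ 2 - 1) / 2) * Real.exp (-(s ^ 2) / 2) := by gcongr
    _ = Real.exp (-1 / 2) := by rw [← Real.exp_add]; ring_nf

theorem mul_exp_neg_sq_anti {s t : ℝ} (ht : 1 ≤ t) (hts : t ≤ s) :
    s * Real.exp (-(s ^ 2) / 2) ≤ t * Real.exp (-(t ^ 2) / 2) := by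
  have h1 : s ≤ t * Real.exp ((s ^ 2 - t ^ 2) / 2) := by
    have := Real.add_one_le_exp ((s ^ 2 - t ^ 2) / 2)
    have h2 : s ≤ t * ((s ^ 2 - t ^ 2) / 2 + 1) := by
      nlinarith [mul_nonneg (sub_nonneg.2 hts) (by nlinarith : (0:ℝ) ≤ t * (s + t) - 2)]
    exact h2.trans (by gcongr)
  calc s * Real.exp (-(s ^ 2) / 2)
      ≤ t * Real.exp ((s ^ 2 - t ^ 2) / 2) * Real.exp (-(s ^ 2) / 2) := by gcongr
    _ = t * Real.exp (-(t ^ 2) / 2) := by rw [mul_assoc, ← Real.exp_add]; ring_nf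

/-- The profile bounding `s * exp (-s² / 2)` for all `s ≥ t ^ k`; it is constant on `(-∞, 1]`
and has an explicit antiderivative on `(1, ∞)`. -/
def regretProfile (k t : ℝ) : ℝ :=
  if t ≤ 1 then Real.exp (-1 / 2) else t ^ (2 * k - 1) * Real.exp (-(t ^ (2 * k)) / 2)

theorem regretProfile_nonneg (k t : ℝ) : 0 ≤ regretProfile k t := by
  unfold regretProfile
  split_ifs with h
  · positivity
  · have : 0 ≤ t := by linarith
    positivity

theorem mul_exp_neg_sq_le_regretProfile {k s t : ℝ} (hk : 1 ≤ k) (hs : t ^ k ≤ s) :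
    s * Real.exp (-(s ^ 2) / 2) ≤ regretProfile k t := by
  unfold regretProfile
  split_ifs with h
  · exact mul_exp_neg_sq_le s
  · push Not at h
    have ht0 : 0 ≤ t := by linarith
    have h1 : 1 ≤ t ^ k := Real.one_le_rpow h.le (by linarith)
    refine (mul_exp_neg_sq_anti h1 hs).trans ?_
    have h2 : (t ^ k) ^ 2 = t ^ (2 * k) := by
      rw [← Real.rpow_natCast, ← Real.rpow_mul ht0]; congr 1; push_cast; ring
    rw [h2]
    gcongr
    · exact h.le
    · linarith

theorem regretProfile_Ioi_one {k : ℝ} (hk : 1 ≤ k) :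
    IntegrableOn (regretProfile k) (Ioi 1) ∧
      ∫ t in Ioi 1, regretProfile k t = Real.exp (-1 / 2) / k := by
  have hk0 : k ≠ 0 := by linarith
  have hderiv : ∀ x ∈ Ici (1:ℝ), HasDerivAt (fun t : ℝ => -(Real.exp (-(t ^ (2 * k)) / 2) / k))
      (x ^ (2 * k - 1) * Real.exp (-(x ^ (2 * k)) / 2)) x := by
    intro x hx
    have hx0 : x ≠ 0 := by have : (1:ℝ) ≤ x := hx; linarith
    have h := (((Real.hasDerivAt_rpow_const (p := 2 * k)
      (Or.inl hx0)).neg.div_const 2).exp.div_const k).neg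
    refine h.congr_deriv ?_
    simp only [Pi.neg_apply]
    field_simp
  have hpos : ∀ x ∈ Ioi (1:ℝ), 0 ≤ x ^ (2 * k - 1) * Real.exp (-(x ^ (2 * k)) / 2) := by
    intro x hx
    have : 0 ≤ x := by have : (1:ℝ) < x := hx; linarith
    positivity
  have hlim : Tendsto (fun t : ℝ => -(Real.exp (-(t ^ (2 * k)) / 2) / k)) atTop (𝓝 0) := by
    have h1 : Tendsto (fun t : ℝ => -(t ^ (2 * k)) / 2) atTop atBot := by
      have := (tendsto_rpow_atTop (y := 2 * k) (by linarith)).atTop_div_const (two_pos)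
      simpa [Function.comp_def, neg_div] using tendsto_neg_atTop_atBot.comp this
    simpa using ((Real.tendsto_exp_atBot.comp h1).div_const k).neg
  have hcongr : EqOn (fun x : ℝ => x ^ (2 * k - 1) * Real.exp (-(x ^ (2 * k)) / 2))
      (regretProfile k) (Ioi 1) := by
    intro x hx
    have : ¬ x ≤ 1 := not_le.2 hx
    simp [regretProfile, this]
  constructor
  · exact (integrableOn_Ioi_deriv_of_nonneg' hderiv hpos hlim).congr_fun hcongr measurableSet_Ioi
  · rw [← setIntegral_congr_fun measurableSet_Ioi hcongr,
      integral_Ioi_of_hasDerivAt_of_nonneg' hderiv hpos hlim]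
    simp

theorem regretProfile_Ioi_zero {k : ℝ} (hk : 1 ≤ k) :
    IntegrableOn (regretProfile k) (Ioi 0) ∧
      ∫ t in Ioi 0, regretProfile k t = Real.exp (-1 / 2) * (1 + 1 / k) := by
  have hcongr : EqOn (fun _ : ℝ => Real.exp (-1 / 2)) (regretProfile k) (Ioc 0 1) := by
    intro x hx
    simp [regretProfile, hx.2]
  have hint : IntegrableOn (regretProfile k) (Ioc 0 1) :=
    (integrableOn_const (by simp)).congr_fun hcongr measurableSet_Ioc
  obtain ⟨h1, h2⟩ := regretProfile_Ioi_one hk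
  rw [← Ioc_union_Ioi_eq_Ioi (zero_le_one' ℝ)]
  refine ⟨hint.union h1, ?_⟩
  rw [setIntegral_union (Ioc_disjoint_Ioi le_rfl) measurableSet_Ioi hint h1, h2,
    ← setIntegral_congr_fun measurableSet_Ioc hcongr]
  simp
  ring

theorem integrable_comp_abs_of_integrableOn_Ioi {f : ℝ → ℝ} (hf : IntegrableOn f (Ioi 0)) :
    Integrable fun x => f |x| := by
  have h1 : IntegrableOn (fun x => f |x|) (Ioi 0) :=
    hf.congr_fun (fun x hx => by simp [abs_of_pos (mem_Ioi.1 hx)]) measurableSet_Ioi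
  rw [← integrableOn_univ, ← Iic_union_Ioi (a := (0:ℝ))]
  refine IntegrableOn.union ?_ h1
  rw [integrableOn_Iic_iff_integrableOn_Iio]
  have h2 := ((Measure.measurePreserving_neg (volume : Measure ℝ)).integrableOn_comp_preimage
    (Homeomorph.neg ℝ).measurableEmbedding).2 h1
  simpa [Function.comp_def] using h2

theorem lintegral_regretProfile {k : ℝ} (hk : 1 ≤ k) {c : ℝ} (hc : 0 < c) (a : ℝ) :
    ∫⁻ t, ENNReal.ofReal (regretProfile k (|t - a| / c)) =
      ENNReal.ofReal (2 * c * (Real.exp (-1 / 2) * (1 + 1 / k))) := by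
  obtain ⟨h1, h2⟩ := regretProfile_Ioi_zero hk
  have hint : Integrable fun t => regretProfile k |t / c| :=
    (integrable_comp_abs_of_integrableOn_Ioi h1).comp_div hc.ne'
  have heq : (fun t => regretProfile k (|t - a| / c)) = fun t => regretProfile k |(t - a) / c| := by
    simp [abs_div, abs_of_pos hc]
  rw [← ofReal_integral_eq_lintegral_ofReal (heq ▸ hint.comp_sub_right a)
    (Eventually.of_forall fun t => regretProfile_nonneg _ _), heq,
    integral_sub_right_eq_self (fun t => regretProfile k |t / c|) a,
    Measure.integral_comp_div (fun t => regretProfile k |t|) c, integral_comp_abs, h2,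
    abs_of_pos hc, smul_eq_mul]
  ring_nf

end Calculus

section Concentration

theorem hoeffding_pi (μ : Measure ℝ) [IsProbabilityMeasure μ] {n : ℕ} (hn : 1 ≤ n) {f : ℝ → ℝ}
    (hf : Measurable f) {a b : ℝ} (hab : b - a = 1) (hfab : ∀ x, f x ∈ Icc a b) {u : ℝ}
    (hu : 0 ≤ u) :
    (iid μ n).real {ω | u ≤ (∑ i, f (ω i)) / n - ∫ x, f x ∂μ} ≤ Real.exp (-2 * n * u ^ 2) := by
  have hn0 : (0:ℝ) < n := by exact_mod_cast hn
  have hsub := hasSubgaussianMGF_of_mem_Icc (μ := μ) hf.aemeasurable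
    (Eventually.of_forall hfab)
  have hind : iIndepFun (fun (_ : Fin n) (ω : Fin n → ℝ) => f (ω _) - ∫ x, f x ∂μ)
      (Measure.pi fun _ => μ) :=
    iIndepFun_pi (X := fun _ x => f x - ∫ x, f x ∂μ) fun _ => by fun_prop
  have hsub' : ∀ i ∈ (Finset.univ : Finset (Fin n)),
      HasSubgaussianMGF (fun ω : Fin n → ℝ => f (ω i) - ∫ x, f x ∂μ) ((‖b - a‖₊ / 2) ^ 2)
        (Measure.pi fun _ => μ) := by
    intro i _
    refine HasSubgaussianMGF.of_map (X := fun x => f x - ∫ x, f x ∂μ)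
      (Y := fun ω : Fin n → ℝ => ω i)
      (measurable_pi_apply i).aemeasurable ?_
    rw [(measurePreserving_eval (fun _ => μ) i).map_eq]
    exact hsub
  have h := HasSubgaussianMGF.measure_sum_ge_le_of_iIndepFun hind hsub' (ε := n * u) (by positivity)
  have hset : {ω : Fin n → ℝ | u ≤ (∑ i, f (ω i)) / n - ∫ x, f x ∂μ} =
      {ω | n * u ≤ ∑ i, (f (ω i) - ∫ x, f x ∂μ)} := by
    ext ω
    simp only [mem_ofPred_eq, Finset.sum_sub_distrib, Finset.sum_const, Finset.card_univ,
      Fintype.card_fin, nsmul_eq_mul]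
    rw [le_sub_iff_add_le, le_div_iff₀ hn0, le_sub_iff_add_le]
    ring_nf
  rw [iid, hset]
  refine h.trans_eq ?_
  congr 1
  simp [hab]
  field_simp

theorem chebyshev_pi (μ : Measure ℝ) [IsProbabilityMeasure μ] {n : ℕ} (hn : 1 ≤ n) {f : ℝ → ℝ}
    (hf : MemLp f 2 μ) {u : ℝ} (hu : 0 < u) :
    (iid μ n).real {ω | u ≤ |(∑ i, f (ω i)) / n - ∫ x, f x ∂μ|} ≤ Var[f; μ] / (n * u ^ 2) := by
  have hn0 : (0:ℝ) < n := by exact_mod_cast hn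
  have hvar := variance_sum_pi (ι := Fin n) (μ := fun _ => μ) (X := fun _ => f) fun _ => hf
  have hmem : MemLp (∑ i : Fin n, fun ω : Fin n → ℝ => f (ω i)) 2 (Measure.pi fun _ => μ) :=
    memLp_finsetSum' _ fun i _ => hf.comp_measurePreserving (measurePreserving_eval (fun _ => μ) i)
  have hexp : ∫ ω, (∑ i : Fin n, fun ω : Fin n → ℝ => f (ω i)) ω ∂(Measure.pi fun _ => μ) =
      n * ∫ x, f x ∂μ := by
    simp only [Finset.sum_apply]
    rw [integral_finsetSum _ fun i _ => integrable_comp_eval (hf.integrable (by norm_num))]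
    rw [Finset.sum_congr rfl fun i _ => integral_comp_eval (μ := fun _ : Fin n => μ) (i := i)
      hf.aestronglyMeasurable]
    simp
  have h := meas_ge_le_variance_div_sq hmem (c := n * u) (by positivity)
  rw [hexp, hvar] at h
  have hset : {ω : Fin n → ℝ | u ≤ |(∑ i, f (ω i)) / n - ∫ x, f x ∂μ|} =
      {ω | n * u ≤ |(∑ i : Fin n, fun ω : Fin n → ℝ => f (ω i)) ω - n * ∫ x, f x ∂μ|} := by
    ext ω
    simp only [mem_ofPred_eq, Finset.sum_apply]
    have : (∑ i, f (ω i)) - n * ∫ x, f x ∂μ = n * ((∑ i, f (ω i)) / n - ∫ x, f x ∂μ) := by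
      field_simp
    rw [this, abs_mul, abs_of_pos hn0, mul_le_mul_iff_right₀ hn0]
  rw [iid, hset]
  refine (ENNReal.toReal_le_of_le_ofReal (by have := variance_nonneg f μ; positivity) h).trans_eq ?_
  simp
  field_simp

end Concentration

section Regret

variable {μ : Measure ℝ} {q : ℝ}

theorem optDec_nonneg : 0 ≤ optDec q μ :=
  Real.sInf_nonneg fun _ ha => ha.1

theorem cdf'_mono [IsProbabilityMeasure μ] : Monotone (cdf' μ) := fun _ _ h =>
  ENNReal.toReal_mono (measure_ne_top _ _) (measure_mono (Iic_subset_Iic.2 h))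

theorem cdf'_eq_integral (z : ℝ) : cdf' μ z = ∫ x, (if x ≤ z then (1:ℝ) else 0) ∂μ := by
  have : (fun x : ℝ => if x ≤ z then (1:ℝ) else 0) = (Iic z).indicator 1 := by
    ext x; simp [indicator_apply]
  rw [this, integral_indicator_one measurableSet_Iic]
  rfl

theorem le_cdf'_of_optDec_lt [IsProbabilityMeasure μ] (hq : q < 1) {z : ℝ}
    (hz : optDec q μ < z) : q ≤ cdf' μ z := by
  have hne : {a : ℝ | 0 ≤ a ∧ q ≤ cdf' μ a}.Nonempty := by
    have hlim : Tendsto (cdf' μ) atTop (𝓝 1) := by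
      have := (ENNReal.tendsto_toReal (measure_ne_top μ univ)).comp (tendsto_measure_Iic_atTop μ)
      simpa [Function.comp_def, show cdf' μ = fun x => (μ (Iic x)).toReal from rfl] using
        this
    obtain ⟨a, ha, ha0⟩ := ((hlim.eventually (lt_mem_nhds hq)).and (eventually_ge_atTop 0)).exists
    exact ⟨a, ha0, ha.le⟩
  obtain ⟨a, ha, haz⟩ := exists_lt_of_csInf_lt hne hz
  exact ha.2.trans (cdf'_mono haz.le)

theorem cdf'_lt_of_lt_optDec {z : ℝ} (hz0 : 0 ≤ z) (hz : z < optDec q μ) : cdf' μ z < q := by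
  by_contra! h
  exact hz.not_ge (csInf_le ⟨0, fun _ ha => ha.1⟩ ⟨hz0, h⟩)

theorem saa_nonneg {n : ℕ} (ω : Fin n → ℝ) : 0 ≤ saa q n ω :=
  Real.sInf_nonneg fun _ ha => ha.1

theorem empCdf_mono {n : ℕ} (ω : Fin n → ℝ) : Monotone (empCdf n ω) := by
  intro a b h
  unfold empCdf
  gcongr with i
  split_ifs with h1 h2
  · rfl
  · exact absurd (h1.trans h) h2
  · exact zero_le_one
  · rfl

theorem le_empCdf_of_saa_lt (hq : q < 1) {n : ℕ} (hn : 1 ≤ n) {ω : Fin n → ℝ} {z : ℝ}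
    (hz : saa q n ω < z) : q ≤ empCdf n ω z := by
  have hn0 : (n:ℝ) ≠ 0 := by positivity
  have hne : {a : ℝ | 0 ≤ a ∧ q ≤ empCdf n ω a}.Nonempty := by
    refine ⟨∑ i, |ω i|, by positivity, ?_⟩
    have : ∀ i, ω i ≤ ∑ i, |ω i| := fun i => (le_abs_self _).trans
      (Finset.single_le_sum (f := fun i => |ω i|) (fun _ _ => abs_nonneg _) (Finset.mem_univ i))
    simp [empCdf, this, hn0, hq.le]
  obtain ⟨a, ha, haz⟩ := exists_lt_of_csInf_lt hne hz
  exact ha.2.trans (empCdf_mono ω haz.le)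

theorem empCdf_lt_of_lt_saa {n : ℕ} {ω : Fin n → ℝ} {z : ℝ} (hz0 : 0 ≤ z)
    (hz : z < saa q n ω) : empCdf n ω z < q := by
  by_contra! h
  exact hz.not_ge (csInf_le ⟨0, fun _ ha => ha.1⟩ ⟨hz0, h⟩)

theorem nvLoss_eq (q a z : ℝ) : nvLoss q a z = q * (z - a) + max (a - z) 0 := by
  unfold nvLoss
  rcases le_total a z with h | h
  · rw [max_eq_left (by linarith), max_eq_right (by linarith)]; ring
  · rw [max_eq_right (by linarith), max_eq_left (by linarith)]; ring

theorem nvLoss_nonneg (hq : q ∈ Ioo (0:ℝ) 1) (a z : ℝ) : 0 ≤ nvLoss q a z := by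
  have h1 := hq.1.le
  have h2 : 0 ≤ 1 - q := by linarith [hq.2]
  unfold nvLoss
  positivity

theorem integrable_nvLoss [IsProbabilityMeasure μ] (hmean : Integrable (fun z => z) μ) (a : ℝ) :
    Integrable (nvLoss q a) μ := by
  have h : Integrable (fun z => q * (z - a) + max (a - z) 0) μ :=
    ((hmean.sub (integrable_const a)).const_mul q).add ((integrable_const a).sub hmean).pos_part
  exact h.congr (Eventually.of_forall fun z => (nvLoss_eq q a z).symm)

theorem nvLoss_sub_nvLoss {a b : ℝ} (hab : b ≤ a) (z : ℝ) :
    nvLoss q a z - nvLoss q b z = ∫ t in Ioc b a, ((if z ≤ t then (1:ℝ) else 0) - q) := by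
  have hind : (fun t : ℝ => if z ≤ t then (1:ℝ) else 0) = (Ici z).indicator 1 := by
    ext t; simp [indicator_apply]
  have hint : IntegrableOn (fun t : ℝ => if z ≤ t then (1:ℝ) else 0) (Ioc b a) := by
    rw [hind]
    exact (integrableOn_const (by simp)).indicator measurableSet_Ici
  rw [integral_sub hint (integrableOn_const (by simp)), hind,
    integral_indicator_one measurableSet_Ici, measureReal_restrict_apply measurableSet_Ici,
    nvLoss_eq, nvLoss_eq]
  simp only [integral_const, measureReal_restrict_apply_univ, Real.volume_real_Ioc_of_le hab,
    smul_eq_mul]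
  rcases le_or_gt z b with h | h
  · rw [inter_eq_self_of_subset_right fun t ht => mem_Ici.2 (h.trans ht.1.le),
      Real.volume_real_Ioc_of_le hab, max_eq_left (by linarith), max_eq_left (by linarith)]
    ring
  · have : Ici z ∩ Ioc b a = Icc z a := by
      ext t
      exact ⟨fun ht => ⟨ht.1, ht.2.2⟩, fun ht => ⟨ht.1, h.trans_le ht.1, ht.2⟩⟩
    rw [this, Real.volume_real_Icc, max_eq_right (by linarith : b - z ≤ 0)]
    ring

theorem expLoss_sub_expLoss [IsProbabilityMeasure μ] (hmean : Integrable (fun z => z) μ)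
    {a b : ℝ} (hab : b ≤ a) :
    expLoss q μ a - expLoss q μ b = ∫ t in Ioc b a, (cdf' μ t - q) := by
  unfold expLoss
  rw [← integral_sub (integrable_nvLoss hmean a) (integrable_nvLoss hmean b)]
  simp_rw [nvLoss_sub_nvLoss hab]
  have hmeas : Measurable fun p : ℝ × ℝ => (if p.1 ≤ p.2 then (1:ℝ) else 0) - q :=
    (Measurable.ite (measurableSet_le measurable_fst measurable_snd) measurable_const
      measurable_const).sub_const q
  rw [integral_integral_swap]
  · refine integral_congr_ae (Eventually.of_forall fun t => ?_)
    have hind : (fun z : ℝ => if z ≤ t then (1:ℝ) else 0) = (Iic t).indicator 1 := by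
      ext x; simp [indicator_apply]
    simp only
    rw [integral_sub _ (integrable_const q), cdf'_eq_integral]
    · simp
    · rw [hind]
      exact (integrable_const 1).indicator measurableSet_Iic
  · refine Integrable.of_bound hmeas.aestronglyMeasurable (1 + |q|)
      (Eventually.of_forall fun p => ?_)
    refine (norm_sub_le _ _).trans ?_
    simp only [Real.norm_eq_abs]
    gcongr
    split_ifs <;> simp

/-- Pairs of samples `ω` and levels `t` such that `t` separates the optimal decision from the
SAA decision. -/
def separated (q : ℝ) (μ : Measure ℝ) (n : ℕ) : Set ((Fin n → ℝ) × ℝ) :=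
  {p | (optDec q μ < p.2 ∧ empCdf n p.1 p.2 < q) ∨ (p.2 < optDec q μ ∧ q ≤ empCdf n p.1 p.2)}

theorem measurableSet_separated (n : ℕ) : MeasurableSet (separated q μ n) := by
  have hemp : Measurable fun p : (Fin n → ℝ) × ℝ => empCdf n p.1 p.2 := by
    refine (Finset.measurable_fun_sum _ fun i _ => ?_).div_const _
    exact Measurable.ite (measurableSet_le ((measurable_pi_apply i).comp measurable_fst)
      measurable_snd) measurable_const measurable_const
  exact ((measurableSet_lt measurable_const measurable_snd).inter
    (measurableSet_lt hemp measurable_const)).union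
    ((measurableSet_lt measurable_snd measurable_const).inter
    (measurableSet_le measurable_const hemp))

theorem integrableOn_cdf'_sub [IsProbabilityMeasure μ] (a b : ℝ) :
    IntegrableOn (fun t => cdf' μ t - q) (Ioc a b) :=
  (((cdf'_mono.monotoneOn _).integrableOn_isCompact isCompact_Icc).mono_set
    Ioc_subset_Icc_self).sub (integrableOn_const (by simp))

theorem ofReal_regret_le [IsProbabilityMeasure μ] (hq : q < 1)
    (hmean : Integrable (fun z => z) μ) {n : ℕ} (hn : 1 ≤ n) (ω : Fin n → ℝ) :
    ENNReal.ofReal (expLoss q μ (saa q n ω) - expLoss q μ (optDec q μ)) ≤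
      ∫⁻ t in Ioi 0, (separated q μ n).indicator
        (fun p => ENNReal.ofReal |cdf' μ p.2 - q|) (ω, t) := by
  rcases le_total (optDec q μ) (saa q n ω) with h | h
  · rw [expLoss_sub_expLoss hmean h, ofReal_integral_eq_lintegral_ofReal
      (integrableOn_cdf'_sub _ _) ((ae_restrict_mem measurableSet_Ioc).mono fun t ht =>
        sub_nonneg.2 (le_cdf'_of_optDec_lt hq ht.1)), ← restrict_Ioo_eq_restrict_Ioc]
    refine (setLIntegral_mono' measurableSet_Ioo fun t ht => ?_).trans
      (lintegral_mono_set fun t ht => optDec_nonneg.trans_lt ht.1)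
    have hmem : (ω, t) ∈ separated q μ n :=
      Or.inl ⟨ht.1, empCdf_lt_of_lt_saa (optDec_nonneg.trans ht.1.le) ht.2⟩
    rw [indicator_of_mem hmem]
    exact ENNReal.ofReal_le_ofReal (le_abs_self _)
  · rw [← neg_sub, expLoss_sub_expLoss hmean h, ← integral_neg', ← restrict_Ioo_eq_restrict_Ioc,
      ofReal_integral_eq_lintegral_ofReal
      ((integrableOn_cdf'_sub _ _).mono_set Ioo_subset_Ioc_self).neg
      ((ae_restrict_mem measurableSet_Ioo).mono fun t ht => neg_nonneg.2 (sub_nonpos.2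
        (cdf'_lt_of_lt_optDec ((saa_nonneg ω).trans ht.1.le) ht.2).le))]
    refine (setLIntegral_mono' measurableSet_Ioo fun t ht => ?_).trans
      (lintegral_mono_set fun t ht => (saa_nonneg ω).trans_lt ht.1)
    have hmem : (ω, t) ∈ separated q μ n :=
      Or.inr ⟨ht.2, le_empCdf_of_saa_lt hq hn ht.1⟩
    rw [indicator_of_mem hmem]
    exact ENNReal.ofReal_le_ofReal (neg_le_abs _)

theorem lintegral_ofReal_regret_le [IsProbabilityMeasure μ] (hq : q < 1)
    (hmean : Integrable (fun z => z) μ) {n : ℕ} (hn : 1 ≤ n) :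
    ∫⁻ ω, ENNReal.ofReal (expLoss q μ (saa q n ω) - expLoss q μ (optDec q μ)) ∂(iid μ n) ≤
      ∫⁻ t in Ioi 0, ENNReal.ofReal
        (|cdf' μ t - q| * (iid μ n).real {ω | (ω, t) ∈ separated q μ n}) := by
  have : IsProbabilityMeasure (iid μ n) := by unfold iid; infer_instance
  refine (lintegral_mono fun ω => ofReal_regret_le hq hmean hn ω).trans_eq ?_
  rw [lintegral_lintegral_swap]
  · refine lintegral_congr fun t => ?_
    have hm : MeasurableSet {ω | (ω, t) ∈ separated q μ n} :=
      measurable_prodMk_right (measurableSet_separated n)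
    rw [ENNReal.ofReal_mul (abs_nonneg _), ofReal_measureReal, ← setLIntegral_const,
      ← lintegral_indicator hm]
    rfl
  · refine (Measurable.indicator ?_ (measurableSet_separated n)).aemeasurable
    have := cdf'_mono (μ := μ) |>.measurable
    fun_prop

theorem measureReal_separated_le_exp [IsProbabilityMeasure μ] (hq : q < 1) {n : ℕ} (hn : 1 ≤ n)
    {t : ℝ} (ht : 0 ≤ t) :
    (iid μ n).real {ω | (ω, t) ∈ separated q μ n} ≤
      Real.exp (-2 * n * |cdf' μ t - q| ^ 2) := by
  have : IsProbabilityMeasure (iid μ n) := by unfold iid; infer_instance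
  have hmeas : Measurable fun x : ℝ => if x ≤ t then (1:ℝ) else 0 :=
    Measurable.ite measurableSet_Iic measurable_const measurable_const
  rcases le_or_gt t (optDec q μ) with h | h
  · rcases h.eq_or_lt with h | h
    · have : {ω : Fin n → ℝ | (ω, t) ∈ separated q μ n} = ∅ := by
        ext ω; simp [separated, h]
      rw [this, measureReal_empty]
      positivity
    · have hlt := cdf'_lt_of_lt_optDec ht h
      refine le_trans (measureReal_mono fun ω hω => ?_) (hoeffding_pi μ hn hmeas
        (a := 0) (b := 1) (by norm_num) (fun x => by split_ifs <;> simp) (abs_nonneg _))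
      have : q ≤ empCdf n ω t := by
        rcases hω with hω | hω
        · exact absurd hω.1 h.le.not_gt
        · exact hω.2
      rw [← cdf'_eq_integral, mem_ofPred_eq, abs_of_neg (by linarith)]
      unfold empCdf at this
      linarith
  · have hle := le_cdf'_of_optDec_lt hq h
    refine le_trans (measureReal_mono fun ω hω => ?_) (hoeffding_pi μ hn hmeas.neg
      (a := -1) (b := 0) (by norm_num)
      (fun x => by simp only [Pi.neg_apply]; split_ifs <;> simp) (abs_nonneg _))
    have : empCdf n ω t < q := by
      rcases hω with hω | hω
      · exact hω.2
      · exact absurd hω.1 h.le.not_gt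
    simp only [Pi.neg_apply, Finset.sum_neg_distrib, integral_neg]
    rw [← cdf'_eq_integral, mem_ofPred_eq, abs_of_nonneg (by linarith), neg_div]
    unfold empCdf at this
    linarith

theorem measureReal_separated_le_div [IsProbabilityMeasure μ] (hq : q < 1) {n : ℕ} (hn : 1 ≤ n)
    {t : ℝ} (ht : 0 ≤ t) (hu : 0 < |cdf' μ t - q|) :
    (iid μ n).real {ω | (ω, t) ∈ separated q μ n} ≤
      μ.real (Ioi t) / (n * |cdf' μ t - q| ^ 2) := by
  have : IsProbabilityMeasure (iid μ n) := by unfold iid; infer_instance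
  have hmeas : Measurable fun x : ℝ => if x ≤ t then (1:ℝ) else 0 :=
    Measurable.ite measurableSet_Iic measurable_const measurable_const
  have hmem : MemLp (fun x : ℝ => if x ≤ t then (1:ℝ) else 0) 2 μ :=
    MemLp.of_bound hmeas.aestronglyMeasurable 1
      (Eventually.of_forall fun x => by split_ifs <;> simp)
  have hvar : Var[fun x : ℝ => if x ≤ t then (1:ℝ) else 0; μ] ≤ μ.real (Ioi t) := by
    have hcompl : (fun x : ℝ => 1 - if x ≤ t then (1:ℝ) else 0) = (Ioi t).indicator 1 := by
      ext x
      by_cases hx : x ≤ t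
      · simp [hx]
      · simp [hx, not_le.1 hx]
    have hsq : ((Ioi t).indicator 1 : ℝ → ℝ) ^ 2 = (Ioi t).indicator 1 := by
      ext x
      by_cases hx : x ∈ Ioi t <;> simp [hx]
    rw [← variance_const_sub hmeas.aestronglyMeasurable 1, hcompl]
    refine (variance_le_expectation_sq
      (aestronglyMeasurable_one.indicator measurableSet_Ioi)).trans_eq ?_
    rw [hsq, integral_indicator_one measurableSet_Ioi]
  refine le_trans (measureReal_mono fun ω hω => ?_) ((chebyshev_pi μ hn hmem hu).trans (by gcongr))
  rw [← cdf'_eq_integral, mem_ofPred_eq]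
  change _ ≤ |empCdf n ω t - _|
  rcases hω with ⟨h1, h2⟩ | ⟨h1, h2⟩
  · have := le_cdf'_of_optDec_lt hq h1
    simp only at h2
    rw [abs_of_nonneg (by linarith), abs_of_nonpos (by linarith)]
    linarith
  · have := cdf'_lt_of_lt_optDec ht h1
    simp only at h2
    rw [abs_of_nonpos (by linarith), abs_of_nonneg (by linarith)]
    linarith

end Regret

section Clustered

variable {q β γ ζ : ℝ} {μ : Measure ℝ}

theorem Clustered.rpow_le (hβ : 0 ≤ β) (hγ : 0 < γ) (hclus : Clustered q β γ ζ μ) {t : ℝ}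
    (ht : |t - optDec q μ| ≤ ζ) : (γ * |t - optDec q μ|) ^ (β + 1) ≤ |cdf' μ t - q| := by
  have h := hclus t (by rw [abs_le] at ht; exact ⟨by linarith, by linarith⟩)
  have h1 : γ * |t - optDec q μ| ≤ |cdf' μ t - q| ^ ((1:ℝ) / (β + 1)) := by
    rwa [one_div, inv_mul_eq_div, le_div_iff₀' hγ] at h
  calc (γ * |t - optDec q μ|) ^ (β + 1)
      ≤ (|cdf' μ t - q| ^ ((1:ℝ) / (β + 1))) ^ (β + 1) := by gcongr
    _ = |cdf' μ t - q| := by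
      rw [← Real.rpow_mul (abs_nonneg _), one_div_mul_cancel (by linarith), Real.rpow_one]

theorem Clustered.rpow_le_of_le [IsProbabilityMeasure μ] (hq : q < 1) (hβ : 0 ≤ β) (hγ : 0 < γ)
    (hζ : 0 < ζ) (hclus : Clustered q β γ ζ μ) {t : ℝ} (ht0 : 0 ≤ t) (ht : ζ ≤ |t - optDec q μ|) :
    (γ * ζ) ^ (β + 1) ≤ |cdf' μ t - q| := by
  rcases le_abs'.1 ht with h | h
  · have hs := hclus.rpow_le (t := optDec q μ - ζ) hβ hγ (by simp [abs_of_pos hζ])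
    have h1 := cdf'_mono (μ := μ) (show t ≤ optDec q μ - ζ by linarith)
    have h2 := cdf'_lt_of_lt_optDec (μ := μ) (show 0 ≤ optDec q μ - ζ by linarith)
      (by linarith : _ < optDec q μ)
    rw [abs_of_neg (by linarith : cdf' μ (optDec q μ - ζ) - q < 0)] at hs
    rw [abs_of_neg (by linarith)]
    simp only [sub_sub_cancel_left, abs_neg, abs_of_pos hζ] at hs
    linarith
  · have hs := hclus.rpow_le (t := optDec q μ + ζ) hβ hγ (by simp [abs_of_pos hζ])
    have h1 := cdf'_mono (μ := μ) (show optDec q μ + ζ ≤ t by linarith)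
    have h2 := le_cdf'_of_optDec_lt hq (by linarith : optDec q μ < optDec q μ + ζ)
    rw [abs_of_nonneg (by linarith : 0 ≤ cdf' μ (optDec q μ + ζ) - q)] at hs
    rw [abs_of_nonneg (by linarith)]
    simp only [add_sub_cancel_left, abs_of_pos hζ] at hs
    linarith

theorem Clustered.abs_mul_measureReal_separated_le [IsProbabilityMeasure μ] (hq : q < 1)
    (hβ : 0 ≤ β) (hγ : 0 < γ) (hζ : 0 < ζ) (hclus : Clustered q β γ ζ μ) {n : ℕ} (hn : 1 ≤ n)
    {t : ℝ} (ht0 : 0 ≤ t) :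
    |cdf' μ t - q| * (iid μ n).real {ω | (ω, t) ∈ separated q μ n} ≤
      1 / (2 * √n) * regretProfile (β + 1)
        (|t - optDec q μ| / ((1 / (2 * √n)) ^ (1 / (β + 1)) / γ)) +
      1 / (n * (γ * ζ) ^ (β + 1)) * μ.real (Ioi t) := by
  have hn0 : (0:ℝ) < n := by exact_mod_cast hn
  have hK : 0 < 1 / (2 * √(n:ℝ)) := by positivity
  set u := |cdf' μ t - q| with hu
  set K := 1 / (2 * √(n:ℝ)) with hKdef
  rcases le_total |t - optDec q μ| ζ with h | h
  · have hle := hclus.rpow_le hβ hγ h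
    have hprof : (|t - optDec q μ| / (K ^ (1 / (β + 1)) / γ)) ^ (β + 1) ≤ u / K := by
      have h1 : |t - optDec q μ| / (K ^ (1 / (β + 1)) / γ) =
          γ * |t - optDec q μ| / K ^ (1 / (β + 1)) := by
        field_simp
      rw [h1, Real.div_rpow (by positivity) (by positivity), ← Real.rpow_mul hK.le,
        one_div_mul_cancel (by linarith), Real.rpow_one]
      gcongr
    have hexp := measureReal_separated_le_exp (μ := μ) hq hn ht0
    have hsq : -2 * n * u ^ 2 = -((u / K) ^ 2) / 2 := by
      rw [hKdef]
      field_simp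
      rw [Real.sq_sqrt hn0.le]
      ring
    rw [← hu, hsq] at hexp
    have hmain := mul_exp_neg_sq_le_regretProfile (by linarith : 1 ≤ β + 1) hprof
    calc u * (iid μ n).real {ω | (ω, t) ∈ separated q μ n}
        ≤ u * Real.exp (-((u / K) ^ 2) / 2) := by gcongr
      _ = K * (u / K * Real.exp (-((u / K) ^ 2) / 2)) := by field_simp
      _ ≤ K * regretProfile (β + 1) (|t - optDec q μ| / (K ^ (1 / (β + 1)) / γ)) := by gcongr
      _ ≤ _ := le_add_of_nonneg_right (by positivity)
  · have hle := hclus.rpow_le_of_le hq hβ hγ hζ ht0 h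
    have hδ : 0 < (γ * ζ) ^ (β + 1) := by positivity
    have hu0 : 0 < u := hδ.trans_le hle
    calc u * (iid μ n).real {ω | (ω, t) ∈ separated q μ n}
        ≤ u * (μ.real (Ioi t) / (n * u ^ 2)) := by
          gcongr
          exact measureReal_separated_le_div hq hn ht0 hu0
      _ = 1 / (n * u) * μ.real (Ioi t) := by field_simp
      _ ≤ 1 / (n * (γ * ζ) ^ (β + 1)) * μ.real (Ioi t) := by gcongr
      _ ≤ _ := le_add_of_nonneg_left (mul_nonneg hK.le (regretProfile_nonneg _ _))

theorem Clustered.lintegral_regret_le [IsProbabilityMeasure μ] (hq : q < 1) (hβ : 0 ≤ β)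
    (hγ : 0 < γ) (hζ : 0 < ζ) (hsupp : μ (Iio 0) = 0) (hmean : Integrable (fun z => z) μ)
    (hmean1 : ∫ z, z ∂μ ≤ 1) (hclus : Clustered q β γ ζ μ) {n : ℕ} (hn : 1 ≤ n) :
    ∫⁻ ω, ENNReal.ofReal (expLoss q μ (saa q n ω) - expLoss q μ (optDec q μ)) ∂(iid μ n) ≤
      ENNReal.ofReal (1 / (2 * √n) * (2 * ((1 / (2 * √n)) ^ (1 / (β + 1)) / γ) *
        (Real.exp (-1 / 2) * (1 + 1 / (β + 1)))) + 1 / (n * (γ * ζ) ^ (β + 1))) := by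
  have hn0 : (0:ℝ) < n := by exact_mod_cast hn
  have hnonneg : 0 ≤ᵐ[μ] fun z => z := by
    filter_upwards [measure_eq_zero_iff_ae_notMem.1 hsupp] with z hz using not_lt.1 hz
  have htail : ∫⁻ t in Ioi 0, ENNReal.ofReal (μ.real (Ioi t)) ≤ 1 := by
    have htoReal : ∀ t, ENNReal.ofReal (μ.real (Ioi t)) = μ (Ioi t) := fun t =>
      ofReal_measureReal
    simp only [htoReal]
    refine (lintegral_eq_lintegral_meas_lt μ hnonneg aemeasurable_id').symm.trans_le ?_
    rw [← ofReal_integral_eq_lintegral_ofReal hmean hnonneg]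
    exact ENNReal.ofReal_le_one.2 hmean1
  have hanti : Antitone fun t => μ.real (Ioi t) := fun a b h =>
    measureReal_mono (Ioi_subset_Ioi h)
  have hmeas : Measurable fun t => μ.real (Ioi t) := hanti.measurable
  refine (lintegral_ofReal_regret_le hq hmean hn).trans ?_
  refine (setLIntegral_mono' measurableSet_Ioi fun t ht => ENNReal.ofReal_le_ofReal
    (hclus.abs_mul_measureReal_separated_le hq hβ hγ hζ hn (le_of_lt ht))).trans ?_
  have hsplit : ∀ t, ENNReal.ofReal (1 / (2 * √n) * regretProfile (β + 1)
        (|t - optDec q μ| / ((1 / (2 * √n)) ^ (1 / (β + 1)) / γ)) +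
      1 / (n * (γ * ζ) ^ (β + 1)) * μ.real (Ioi t)) =
      ENNReal.ofReal (1 / (2 * √n)) * ENNReal.ofReal (regretProfile (β + 1)
        (|t - optDec q μ| / ((1 / (2 * √n)) ^ (1 / (β + 1)) / γ))) +
      ENNReal.ofReal (1 / (n * (γ * ζ) ^ (β + 1))) * ENNReal.ofReal (μ.real (Ioi t)) := by
    intro t
    have := regretProfile_nonneg (β + 1)
        (|t - optDec q μ| / ((1 / (2 * √n)) ^ (1 / (β + 1)) / γ))
    rw [ENNReal.ofReal_add (by positivity) (by positivity), ENNReal.ofReal_mul (by positivity),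
      ENNReal.ofReal_mul (by positivity)]
  simp_rw [hsplit]
  rw [lintegral_add_right _ (hmeas.ennreal_ofReal.const_mul _),
    lintegral_const_mul' _ _ ENNReal.ofReal_ne_top, lintegral_const_mul' _ _ ENNReal.ofReal_ne_top,
    ENNReal.ofReal_add (by positivity) (by positivity),
    ENNReal.ofReal_mul (p := 1 / (2 * √(n:ℝ))) (by positivity)]
  gcongr
  · exact (setLIntegral_le_lintegral _ _).trans_eq
      (lintegral_regretProfile (by linarith) (by positivity) _)
  · exact mul_le_of_le_one_right' htail

end Clustered

theorem integral_le_of_lintegral_ofReal_le {Ω : Type*} [MeasurableSpace Ω] {P : Measure Ω}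
    {f : Ω → ℝ} (hf : Integrable f P) {C : ℝ} (hC : 0 ≤ C)
    (h : ∫⁻ ω, ENNReal.ofReal (f ω) ∂P ≤ ENNReal.ofReal C) : ∫ ω, f ω ∂P ≤ C := by
  rw [integral_eq_lintegral_pos_part_sub_lintegral_neg_part hf]
  have := ENNReal.toReal_le_of_le_ofReal hC h
  linarith [ENNReal.toReal_nonneg (a := ∫⁻ ω, ENNReal.ofReal (-f ω) ∂P)]

/-- Expected additive regret upper bound for SAA on `(β,γ,ζ)`-clustered
distributions with mean at most 1: for every `n ≥ 1`,
`E[L(â)] − L(a*) ≤ (2/γ)·(1/(β+1) + 1/√e)·(1/(2√n))^{(β+2)/(β+1)} + (q+1)/(n(γζ)^{β+1})`. -/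
theorem saa_expected_additive_regret_clustered
    (q β γ ζ : ℝ) (hq : q ∈ Ioo (0:ℝ) 1) (hβ : 0 ≤ β) (hγ : 0 < γ)
    (hζ : ζ ∈ Ioc 0 ((min q (1 - q)) ^ ((1:ℝ)/(β+1)) / γ))
    (μ : Measure ℝ) [IsProbabilityMeasure μ] (hsupp : μ (Iio 0) = 0)
    (hmean : Integrable (fun z => z) μ) (hmean1 : (∫ z, z ∂μ) ≤ 1)
    (hclus : Clustered q β γ ζ μ)
    (n : ℕ) (hn : 1 ≤ n) :
    (∫ ω, expLoss q μ (saa q n ω) ∂(iid μ n)) - expLoss q μ (optDec q μ)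
      ≤ (2/γ) * (1/(β+1) + 1/Real.sqrt (Real.exp 1))
            * (1/(2*Real.sqrt n)) ^ ((β+2)/(β+1))
        + (q+1) / (n * (γ*ζ) ^ (β+1)) := by
  obtain ⟨hq0, hq1⟩ := hq
  have hn0 : (0:ℝ) < n := by exact_mod_cast hn
  have hζ0 := hζ.1
  have : IsProbabilityMeasure (iid μ n) := by unfold iid; infer_instance
  by_cases hint : Integrable (fun ω => expLoss q μ (saa q n ω)) (iid μ n)
  swap
  · rw [integral_undef hint]
    have h1 : 0 ≤ expLoss q μ (optDec q μ) := integral_nonneg fun z => nvLoss_nonneg ⟨hq0, hq1⟩ _ z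
    refine le_trans (by linarith : _ ≤ (0:ℝ)) ?_
    positivity
  have hlin := hclus.lintegral_regret_le hq1 hβ hγ hζ0 hsupp hmean hmean1 hn
  have hint' := hint.sub (integrable_const (expLoss q μ (optDec q μ)))
  have hmain := integral_le_of_lintegral_ofReal_le hint' (by positivity) hlin
  simp only [Pi.sub_apply] at hmain
  rw [integral_sub hint (integrable_const _)] at hmain
  simp only [integral_const, probReal_univ, one_smul] at hmain
  refine hmain.trans (add_le_add ?_ ?_)
  · have hexp : Real.exp (-1 / 2) = 1 / √(Real.exp 1) := by
      rw [← Real.exp_half, neg_div, Real.exp_neg, one_div (Real.exp _)]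
    have hexp1 : Real.exp (-1 / 2) ≤ 1 := Real.exp_le_one_iff.2 (by norm_num)
    have hpow : (1 / (2 * √(n:ℝ))) ^ ((β + 2) / (β + 1)) =
        (1 / (2 * √(n:ℝ))) ^ (1 / (β + 1)) * (1 / (2 * √(n:ℝ))) := by
      rw [← Real.rpow_add_one (by positivity)]
      congr 1
      field_simp
      ring
    rw [← hexp, hpow]
    calc 1 / (2 * √(n:ℝ)) * (2 * ((1 / (2 * √(n:ℝ))) ^ (1 / (β + 1)) / γ) *
          (Real.exp (-1 / 2) * (1 + 1 / (β + 1))))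
        = 2 / γ * (Real.exp (-1 / 2) * (1 / (β + 1)) + Real.exp (-1 / 2)) *
          ((1 / (2 * √(n:ℝ))) ^ (1 / (β + 1)) * (1 / (2 * √(n:ℝ)))) := by ring
      _ ≤ _ := by
        gcongr
        exact mul_le_of_le_one_left (by positivity) hexp1
  · gcongr
    linarith
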